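/- Let K be a field, m ≥ 3 and n ≥ 2m integers, k = ⌊(n+1)/(m+1)⌋, and suppose 1 < a < m−1 where a = n+1 − k(m+1). Let L_{k−1} = (I_{n,m} : x_m x_{2m+1} ⋯ x_{(k−1)(m+1)−1}) and U_k = L_{k−1} + (x_{k(m+1)−1}). Then depth(S/U_k) = n − 2k + 1 = (n + 1 − ⌊(n+1)/(m+1)⌋ − ⌈(n+1)/(m+1)⌉) + 1. -/

import Mathlib

open MvPolynomial

/-- The generator `u_i = x_i x_{i+1} ⋯ x_{i+m-1}` of the path ideal, where the
variables of `K[x_1,…,x_n]` are 1-indexed via `x_t = X ⟨t-1⟩`. -/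
noncomputable def pathGen (K : Type) [Field K] (n m i : ℕ) : MvPolynomial (Fin n) K :=
  ∏ j ∈ Finset.univ.filter (fun j : Fin n => i ≤ (j : ℕ) + 1 ∧ (j : ℕ) + 1 < i + m),
    X j

/-- The monomial `u_i / x_p = ∏_{i ≤ l ≤ i+m-1, l ≠ p} x_l`. -/
noncomputable def pathGenDiv (K : Type) [Field K] (n m i p : ℕ) : MvPolynomial (Fin n) K :=
  ∏ j ∈ Finset.univ.filter
      (fun j : Fin n => (i ≤ (j : ℕ) + 1 ∧ (j : ℕ) + 1 < i + m) ∧ (j : ℕ) + 1 ≠ p),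
    X j

/-- The path ideal `I_{n,m} = (u_1, …, u_{n-m+1}) ⊆ K[x_1,…,x_n]` of the line graph. -/
noncomputable def pathIdeal (K : Type) [Field K] (n m : ℕ) : Ideal (MvPolynomial (Fin n) K) :=
  Ideal.span {q | ∃ i : ℕ, 1 ≤ i ∧ i ≤ n - m + 1 ∧ q = pathGen K n m i}

/-- The variable `x_t` of `K[x_1,…,x_n]` (1-indexed; junk value `0` out of range). -/
noncomputable def xv (K : Type) [Field K] (n t : ℕ) : MvPolynomial (Fin n) K :=
  if h : 1 ≤ t ∧ t ≤ n then X (⟨t - 1, by omega⟩ : Fin n) else 0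

/-- The set of lengths of `(S/I)`-regular sequences consisting of homogeneous
elements of the graded maximal ideal `(x_1,…,x_n)` of `S = K[x_1,…,x_n]`.
The depth of `S/I` is the greatest element of this set. -/
def homogRegSeqLengths (K : Type) [Field K] (n : ℕ)
    (I : Ideal (MvPolynomial (Fin n) K)) : Set ℕ :=
  {d | ∃ rs : List (MvPolynomial (Fin n) K), rs.length = d ∧
    (∀ f ∈ rs, (∃ e : ℕ, f.IsHomogeneous e) ∧
      f ∈ Ideal.span (Set.range (X : Fin n → MvPolynomial (Fin n) K))) ∧
    RingTheory.Sequence.IsRegular (MvPolynomial (Fin n) K ⧸ I) rs}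

open RingTheory.Sequence

open scoped Pointwise in
theorem isWeaklyRegular_quotient_cons_iff {R : Type*} [CommRing R] (I : Ideal R) (f : R)
    (fs : List R) :
    IsWeaklyRegular (R ⧸ I) (f :: fs) ↔
      (∀ g, f * g ∈ I → g ∈ I) ∧ IsWeaklyRegular (R ⧸ (I ⊔ Ideal.span {f})) fs := by
  rw [isWeaklyRegular_cons_iff]
  refine and_congr ?_ ?_
  · rw [isSMulRegular_iff_right_eq_zero_of_smul]
    refine Ideal.Quotient.mk_surjective.forall.trans (forall_congr' fun g => ?_)
    rw [← Ideal.Quotient.eq_zero_iff_mem, ← Ideal.Quotient.eq_zero_iff_mem, map_mul]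
    rfl
  · have h : f • (⊤ : Submodule R (R ⧸ I)) = Submodule.map I.mkQ (Ideal.span {f}) := by
      rw [← Submodule.ideal_span_singleton_smul, ← Submodule.range_mkQ I, ← Submodule.map_top,
        ← Submodule.map_smul'']
      simp
    exact ((Submodule.quotEquivOfEq _ _ h).trans
      (Submodule.quotientQuotientEquivQuotientSup I (Ideal.span {f}))).isWeaklyRegular_congr fs

theorem isWeaklyRegular_of_colon_of_sup {R : Type*} [CommRing R] {I : Ideal R} {x : R}
    {fs : List R} (hcolon : IsWeaklyRegular (R ⧸ I.colon {x}) fs)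
    (hsup : IsWeaklyRegular (R ⧸ (I ⊔ Ideal.span {x})) fs) : IsWeaklyRegular (R ⧸ I) fs := by
  induction fs generalizing I with
  | nil => exact IsWeaklyRegular.nil R _
  | cons f fs ih =>
    rw [isWeaklyRegular_quotient_cons_iff] at hcolon hsup ⊢
    refine ⟨fun g hg => ?_, ih ?_ ?_⟩
    · obtain ⟨i, hi, y, hy, rfl⟩ := Submodule.mem_sup.1 (hsup.1 g (Ideal.mem_sup_left hg))
      obtain ⟨h, rfl⟩ := Ideal.mem_span_singleton'.1 hy
      refine I.add_mem hi ?_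
      refine Submodule.mem_colon_singleton.1 (hcolon.1 h (Submodule.mem_colon_singleton.2 ?_))
      rw [smul_eq_mul]
      convert I.sub_mem hg (I.mul_mem_left f hi) using 1
      ring
    · suffices h : (I ⊔ Ideal.span {f}).colon {x} = I.colon {x} ⊔ Ideal.span {f} by
        rw [h]
        exact hcolon.2
      refine le_antisymm (fun g hg => ?_) (sup_le (fun g hg => ?_) ?_)
      · obtain ⟨i, hi, y, hy, e⟩ := Submodule.mem_sup.1 (Submodule.mem_colon_singleton.1 hg)
        obtain ⟨h, rfl⟩ := Ideal.mem_span_singleton'.1 hy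
        have h1 : f * h ∈ I ⊔ Ideal.span {x} := by
          rw [show f * h = -i + g * x by rw [← smul_eq_mul g x, ← e]; ring]
          exact Ideal.add_mem _ (Ideal.mem_sup_left (I.neg_mem hi))
            (Ideal.mem_sup_right (Ideal.mul_mem_left _ _ (Ideal.mem_span_singleton_self x)))
        obtain ⟨j, hj, z, hz, rfl⟩ := Submodule.mem_sup.1 (hsup.1 h h1)
        obtain ⟨q, rfl⟩ := Ideal.mem_span_singleton'.1 hz
        rw [show g = (g - f * q) + f * q by ring]
        refine Ideal.add_mem _ (Ideal.mem_sup_left (Submodule.mem_colon_singleton.2 ?_))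
          (Ideal.mem_sup_right (Ideal.mul_mem_right _ _ (Ideal.mem_span_singleton_self f)))
        rw [smul_eq_mul] at e ⊢
        rw [show (g - f * q) * x = i + f * j by rw [sub_mul, ← e]; ring]
        exact I.add_mem hi (I.mul_mem_left f hj)
      · exact Submodule.mem_colon_singleton.2
          (Ideal.mem_sup_left (Submodule.mem_colon_singleton.1 hg))
      · rw [Ideal.span_singleton_le_iff_mem, Submodule.mem_colon_singleton]
        exact Ideal.mem_sup_right (Ideal.mul_mem_right _ _ (Ideal.mem_span_singleton_self f))
    · rw [sup_right_comm]
      exact hsup.2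

attribute [local instance] MvPolynomial.gradedAlgebra

theorem mem_of_forall_mem_sup_span_pow {σ K : Type*} [Field K] {J : Ideal (MvPolynomial σ K)}
    (hJ : J.IsHomogeneous (homogeneousSubmodule σ K)) {f : MvPolynomial σ K} {e : ℕ}
    (hf : f.IsHomogeneous e) (he : 0 < e) {g : MvPolynomial σ K}
    (hg : ∀ i : ℕ, g ∈ J ⊔ Ideal.span {f ^ i}) : g ∈ J := by
  rw [mem_iff_homogeneousComponent_mem hJ]
  intro t
  obtain ⟨j, hj, y, hy, rfl⟩ := Submodule.mem_sup.1 (hg (t + 1))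
  obtain ⟨h, rfl⟩ := Ideal.mem_span_singleton'.1 hy
  rw [map_add]
  have h0 : homogeneousComponent t (h * f ^ (t + 1)) = 0 := by
    rw [← sum_homogeneousComponent h, Finset.sum_mul, map_sum]
    refine Finset.sum_eq_zero fun i _ => ?_
    rw [homogeneousComponent_of_mem (n := i + e * (t + 1))
      ((homogeneousComponent_isHomogeneous i h).mul (hf.pow (t + 1))), if_neg]
    nlinarith
  rw [h0, add_zero]
  exact homogeneousComponent_mem_of_mem hJ hj t

theorem isHomogeneous_sup_span_singleton {σ K : Type*} [Field K] {J : Ideal (MvPolynomial σ K)}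
    (hJ : J.IsHomogeneous (homogeneousSubmodule σ K)) {f : MvPolynomial σ K} {e : ℕ}
    (hf : f.IsHomogeneous e) :
    (J ⊔ Ideal.span {f}).IsHomogeneous (homogeneousSubmodule σ K) := by
  refine hJ.sup (Ideal.homogeneous_span _ _ fun y hy => ?_)
  rw [Set.mem_singleton_iff.1 hy]
  exact ⟨e, hf⟩

theorem isWeaklyRegular_of_isWeaklyRegular_sup {σ K : Type*} [Field K]
    {J : Ideal (MvPolynomial σ K)} (hJ : J.IsHomogeneous (homogeneousSubmodule σ K))
    {x : MvPolynomial σ K} {e : ℕ} (hx : x.IsHomogeneous e) (he : 0 < e)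
    (hreg : ∀ g, x * g ∈ J → g ∈ J) {fs : List (MvPolynomial σ K)}
    (hhom : ∀ f ∈ fs, ∃ d, f.IsHomogeneous d)
    (hfs : IsWeaklyRegular (MvPolynomial σ K ⧸ (J ⊔ Ideal.span {x})) fs) :
    IsWeaklyRegular (MvPolynomial σ K ⧸ J) fs ∧
      ∀ g, x * g ∈ J ⊔ Ideal.ofList fs → g ∈ J ⊔ Ideal.ofList fs := by
  induction fs generalizing J with
  | nil => exact ⟨IsWeaklyRegular.nil _ _, by simpa using hreg⟩
  | cons f fs ih =>
    rw [isWeaklyRegular_quotient_cons_iff] at hfs ⊢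
    rw [Ideal.ofList_cons, ← sup_assoc, and_assoc]
    obtain ⟨d, hd⟩ := hhom f (by simp)
    refine ⟨fun g hg => mem_of_forall_mem_sup_span_pow hJ hx he fun i => ?_,
      ih (isHomogeneous_sup_span_singleton hJ hd) (fun g hg => ?_)
        (fun y hy => hhom y (by simp [hy])) ?_⟩
    · induction i generalizing g with
      | zero => simp
      | succ i ihi =>
        obtain ⟨j, hj, y, hy, rfl⟩ := Submodule.mem_sup.1 (hfs.1 g (Ideal.mem_sup_left hg))
        obtain ⟨h, rfl⟩ := Ideal.mem_span_singleton'.1 hy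
        have h1 : f * h ∈ J := by
          refine hreg _ ?_
          convert J.sub_mem hg (J.mul_mem_left f hj) using 1
          ring
        obtain ⟨j', hj', z, hz, rfl⟩ := Submodule.mem_sup.1 (ihi h h1)
        obtain ⟨q, rfl⟩ := Ideal.mem_span_singleton'.1 hz
        rw [show j + (j' + q * x ^ i) * x = (j + j' * x) + q * x ^ (i + 1) by ring]
        exact Ideal.add_mem _
          (Ideal.mem_sup_left (J.add_mem hj (J.mul_mem_right _ hj')))
          (Ideal.mem_sup_right (Ideal.mul_mem_left _ _ (Ideal.mem_span_singleton_self _)))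
    · obtain ⟨j, hj, y, hy, e⟩ := Submodule.mem_sup.1 hg
      obtain ⟨h, rfl⟩ := Ideal.mem_span_singleton'.1 hy
      have h1 : f * h ∈ J ⊔ Ideal.span {x} := by
        rw [show f * h = -j + g * x by linear_combination e]
        exact Ideal.add_mem _ (Ideal.mem_sup_left (J.neg_mem hj))
          (Ideal.mem_sup_right (Ideal.mul_mem_left _ _ (Ideal.mem_span_singleton_self x)))
      obtain ⟨j', hj', z, hz, rfl⟩ := Submodule.mem_sup.1 (hfs.1 h h1)
      obtain ⟨q, rfl⟩ := Ideal.mem_span_singleton'.1 hz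
      rw [show g = (g - f * q) + f * q by ring]
      refine Ideal.add_mem _ (Ideal.mem_sup_left (hreg _ ?_))
        (Ideal.mem_sup_right (Ideal.mul_mem_right _ _ (Ideal.mem_span_singleton_self f)))
      rw [show x * (g - f * q) = j + f * j' by linear_combination -e]
      exact J.add_mem hj (J.mul_mem_left f hj')
    · rw [sup_right_comm]
      exact hfs.2

theorem length_le_coheight {n : ℕ} {K : Type*} [Field K]
    {J : Ideal (MvPolynomial (Fin n) K)}
    (hJ : J.IsHomogeneous (homogeneousSubmodule (Fin n) K)) (P : PrimeSpectrum (MvPolynomial (Fin n) K))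
    {w : MvPolynomial (Fin n) K} (hw : w ∉ J) (hPw : ∀ p ∈ P.asIdeal, p * w ∈ J)
    {fs : List (MvPolynomial (Fin n) K)}
    (hhom : ∀ f ∈ fs, ∃ d, 0 < d ∧ f.IsHomogeneous d)
    (hfs : IsWeaklyRegular (MvPolynomial (Fin n) K ⧸ J) fs) :
    (fs.length : ℕ∞) ≤ Order.coheight P := by
  induction fs generalizing J P w with
  | nil => simp
  | cons f fs ih =>
    rw [isWeaklyRegular_quotient_cons_iff] at hfs
    obtain ⟨d, hd0, hd⟩ := hhom f (by simp)
    have hn : ∃ v, (∀ p ∈ P.asIdeal, p * v ∈ J) ∧ v ∉ J ⊔ Ideal.span {f} := by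
      by_contra! hcon
      refine hw (mem_of_forall_mem_sup_span_pow hJ hd hd0 fun i => ?_)
      clear hw
      induction i generalizing w with
      | zero => simp
      | succ i ihi =>
        obtain ⟨j, hj, y, hy, rfl⟩ := Submodule.mem_sup.1 (hcon w hPw)
        obtain ⟨h, rfl⟩ := Ideal.mem_span_singleton'.1 hy
        have h1 : ∀ p ∈ P.asIdeal, p * h ∈ J := fun p hp => hfs.1 _ <| by
          convert J.sub_mem (hPw p hp) (J.mul_mem_left p hj) using 1
          ring
        obtain ⟨j', hj', z, hz, rfl⟩ := Submodule.mem_sup.1 (ihi h1)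
        obtain ⟨q, rfl⟩ := Ideal.mem_span_singleton'.1 hz
        rw [show j + (j' + q * f ^ i) * f = (j + j' * f) + q * f ^ (i + 1) by ring]
        exact Ideal.add_mem _
          (Ideal.mem_sup_left (J.add_mem hj (J.mul_mem_right _ hj')))
          (Ideal.mem_sup_right (Ideal.mul_mem_left _ _ (Ideal.mem_span_singleton_self _)))
    obtain ⟨v, hPv, hv⟩ := hn
    obtain ⟨Q, hQ, hle⟩ := exists_le_isAssociatedPrime_of_isNoetherianRing
      (MvPolynomial (Fin n) K) (Ideal.Quotient.mk (J ⊔ Ideal.span {f}) v)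
      (by rwa [Ne, Ideal.Quotient.eq_zero_iff_mem])
    have hle' : ∀ p, p * v ∈ J ⊔ Ideal.span {f} → p ∈ Q := fun p hp => hle <| by
      rw [Submodule.mem_colon_singleton, Submodule.mem_bot]
      exact Ideal.Quotient.eq_zero_iff_mem.2 hp
    obtain ⟨hQp, y, hy⟩ := isAssociatedPrime_iff.1 hQ
    obtain ⟨u, rfl⟩ := Ideal.Quotient.mk_surjective y
    have hQu : ∀ p, p ∈ Q ↔ p * u ∈ J ⊔ Ideal.span {f} := fun p => by
      rw [hy, Submodule.mem_colon_singleton, Submodule.mem_bot, ← Ideal.Quotient.eq_zero_iff_mem]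
      rfl
    have hPQ : P < ⟨Q, hQp⟩ := by
      refine lt_of_le_of_ne (fun p hp => hle' p (Ideal.mem_sup_left (hPv p hp))) fun h => ?_
      have hf : f ∈ P.asIdeal := by
        rw [h]
        exact hle' f (Ideal.mem_sup_right (Ideal.mul_mem_right _ _ (Ideal.mem_span_singleton_self f)))
      exact hw (hfs.1 w (hPw f hf))
    have := ih (isHomogeneous_sup_span_singleton hJ hd) ⟨Q, hQp⟩ (w := u)
      (fun hu => hQp.ne_top ((Ideal.eq_top_iff_one Q).2 ((hQu 1).2 (by rwa [one_mul]))))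
      (fun p hp => (hQu p).1 hp) (fun y hy => hhom y (by simp [hy])) hfs.2
    push_cast [List.length_cons]
    exact (add_le_add_left this 1).trans (Order.coheight_add_one_le hPQ)

theorem isWeaklyRegular_quotient_concat_iff {R : Type*} [CommRing R] (I : Ideal R) (f : R)
    (fs : List R) :
    IsWeaklyRegular (R ⧸ I) (fs ++ [f]) ↔ IsWeaklyRegular (R ⧸ I) fs ∧
      ∀ g, f * g ∈ I ⊔ Ideal.ofList fs → g ∈ I ⊔ Ideal.ofList fs := by
  induction fs generalizing I with
  | nil =>
    rw [List.nil_append, isWeaklyRegular_quotient_cons_iff]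
    simp
  | cons y fs ih =>
    rw [List.cons_append, isWeaklyRegular_quotient_cons_iff, isWeaklyRegular_quotient_cons_iff, ih,
      Ideal.ofList_cons, ← sup_assoc, and_assoc]

/-- The ideal generated by the squarefree monomials with supports in `𝒜`. -/
noncomputable def sqfreeIdeal (K : Type*) [Field K] {σ : Type*} (𝒜 : Set (Finset σ)) :
    Ideal (MvPolynomial σ K) :=
  Ideal.span ((fun A => ∏ j ∈ A, X j) '' 𝒜)

theorem prod_X_eq_monomial (K : Type*) [Field K] {σ : Type*} (A : Finset σ) :
    (∏ j ∈ A, X j : MvPolynomial σ K) = monomial (∑ j ∈ A, Finsupp.single j 1) 1 := by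
  rw [monomial_sum_one]
  rfl

theorem sum_single_one_apply {σ : Type*} [DecidableEq σ] (A : Finset σ) (i : σ) :
    (∑ j ∈ A, Finsupp.single j 1 : σ →₀ ℕ) i = if i ∈ A then 1 else 0 := by
  simp [Finsupp.finsetSum_apply, Finsupp.single_apply]

theorem mem_sqfreeIdeal {K : Type*} [Field K] {σ : Type*} {𝒜 : Set (Finset σ)}
    {p : MvPolynomial σ K} :
    p ∈ sqfreeIdeal K 𝒜 ↔ ∀ s ∈ p.support, ∃ A ∈ 𝒜, ∀ i ∈ A, s i ≠ 0 := by
  classical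
  have h : ((fun A => ∏ j ∈ A, X j) '' 𝒜 : Set (MvPolynomial σ K)) =
      (fun s => monomial s (1 : K)) '' ((fun A => ∑ j ∈ A, Finsupp.single j 1) '' 𝒜) := by
    rw [Set.image_image]
    exact Set.image_congr fun A _ => prod_X_eq_monomial K A
  rw [sqfreeIdeal, h, mem_ideal_span_monomial_image]
  refine forall₂_congr fun s _ => ?_
  rw [Set.exists_mem_image]
  refine exists_congr fun A => and_congr_right fun _ => ?_
  rw [Finsupp.le_def]
  refine forall_congr' fun i => ?_
  rw [sum_single_one_apply]
  split_ifs with hi <;> simp [hi, Nat.one_le_iff_ne_zero]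

theorem sqfreeIdeal_le {K : Type*} [Field K] {σ : Type*} {𝒜 ℬ : Set (Finset σ)}
    (h : ∀ A ∈ 𝒜, ∃ B ∈ ℬ, B ⊆ A) : sqfreeIdeal K 𝒜 ≤ sqfreeIdeal K ℬ := by
  intro p hp
  rw [mem_sqfreeIdeal] at hp ⊢
  intro s hs
  obtain ⟨A, hA, hAs⟩ := hp s hs
  obtain ⟨B, hB, hBA⟩ := h A hA
  exact ⟨B, hB, fun i hi => hAs i (hBA hi)⟩

theorem forall_mem_support_mul_monomial_iff {K : Type*} [Field K] {σ : Type*}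
    (p : MvPolynomial σ K) (t : σ →₀ ℕ) (P : (σ →₀ ℕ) → Prop) :
    (∀ s ∈ (p * monomial t 1).support, P s) ↔ ∀ s ∈ p.support, P (s + t) := by
  refine ⟨fun h s hs => h _ ?_, fun h s hs => ?_⟩
  · rw [mem_support_iff] at hs ⊢
    simpa [coeff_mul_monomial] using hs
  · rw [mem_support_iff, coeff_mul_monomial', mul_one, ne_eq, ite_eq_right_iff, not_forall] at hs
    obtain ⟨hts, hs⟩ := hs
    rw [← tsub_add_cancel_of_le hts]
    exact h _ (mem_support_iff.2 hs)

theorem colon_sqfreeIdeal {K : Type*} [Field K] {σ : Type*} [DecidableEq σ] (𝒜 : Set (Finset σ))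
    (G : Finset σ) :
    (sqfreeIdeal K 𝒜).colon {∏ j ∈ G, X j} = sqfreeIdeal K ((· \ G) '' 𝒜) := by
  ext p
  rw [Submodule.mem_colon_singleton, smul_eq_mul, mem_sqfreeIdeal, mem_sqfreeIdeal,
    prod_X_eq_monomial, forall_mem_support_mul_monomial_iff]
  refine forall₂_congr fun s _ => ?_
  rw [Set.exists_mem_image]
  refine exists_congr fun A => and_congr_right fun _ => forall_congr' fun i => ?_
  simp only [Finsupp.add_apply, sum_single_one_apply, Finset.mem_sdiff]
  by_cases hi : i ∈ G <;> simp [hi]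

theorem sqfreeIdeal_union_singleton {K : Type*} [Field K] {σ : Type*} (𝒜 : Set (Finset σ))
    (v : σ) :
    sqfreeIdeal K 𝒜 ⊔ Ideal.span {X v} = sqfreeIdeal K (𝒜 ∪ {{v}}) := by
  rw [sqfreeIdeal, sqfreeIdeal, Set.image_union, Ideal.span_union, Set.image_singleton,
    Finset.prod_singleton]

theorem isHomogeneous_sqfreeIdeal {K : Type*} [Field K] {σ : Type*} (𝒜 : Set (Finset σ)) :
    (sqfreeIdeal K 𝒜).IsHomogeneous (homogeneousSubmodule σ K) := by
  refine Ideal.homogeneous_span _ _ ?_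
  rintro _ ⟨A, _, rfl⟩
  exact ⟨_, IsHomogeneous.prod A _ (fun _ => 1) fun i _ => isHomogeneous_X K i⟩

/-- The monomial prime ideal generated by the variables in `F`. -/
noncomputable def varIdeal (K : Type*) [Field K] {σ : Type*} (F : Finset σ) :
    Ideal (MvPolynomial σ K) :=
  sqfreeIdeal K ((fun v => {v}) '' (F : Set σ))

theorem mem_varIdeal {K : Type*} [Field K] {σ : Type*} {F : Finset σ} {p : MvPolynomial σ K} :
    p ∈ varIdeal K F ↔ ∀ s ∈ p.support, ∃ v ∈ F, s v ≠ 0 := by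
  simp [varIdeal, mem_sqfreeIdeal]

theorem X_mem_varIdeal {K : Type*} [Field K] {σ : Type*} {F : Finset σ} {v : σ} :
    (X v : MvPolynomial σ K) ∈ varIdeal K F ↔ v ∈ F := by
  classical
  simp [mem_varIdeal, X, support_monomial, Finsupp.single_apply]

theorem varIdeal_sup_span_X {K : Type*} [Field K] {σ : Type*} [DecidableEq σ] (F : Finset σ)
    (v : σ) : varIdeal K F ⊔ Ideal.span {X v} = varIdeal K (insert v F) := by
  rw [varIdeal, sqfreeIdeal_union_singleton, varIdeal, Finset.coe_insert, Set.image_insert_eq,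
    Set.union_singleton]

theorem mem_varIdeal_of_X_mul_mem {K : Type*} [Field K] {σ : Type*} {F : Finset σ} {v : σ}
    (hv : v ∉ F) {g : MvPolynomial σ K} (hg : X v * g ∈ varIdeal K F) : g ∈ varIdeal K F := by
  classical
  rw [mem_varIdeal, support_X_mul, Finset.forall_mem_map] at hg
  rw [mem_varIdeal]
  intro s hs
  obtain ⟨u, hu, h⟩ := hg s hs
  refine ⟨u, hu, ?_⟩
  have : v ≠ u := fun h => hv (h ▸ hu)
  simpa [Finsupp.single_apply, this] using h

theorem mem_of_prod_mul_mem {R ι : Type*} [CommRing R] {L : Ideal R} {x : ι → R} {s : Finset ι}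
    (h : ∀ v ∈ s, ∀ g, x v * g ∈ L → g ∈ L) {g : R} (hg : (∏ v ∈ s, x v) * g ∈ L) : g ∈ L := by
  classical
  induction s using Finset.induction_on with
  | empty => simpa using hg
  | insert v s hv ih =>
    rw [Finset.prod_insert hv, mul_assoc] at hg
    exact ih (fun u hu => h u (by simp [hu])) (h v (by simp) _ hg)

theorem esymm_isHomogeneous (σ K : Type*) [Fintype σ] [Field K] (d : ℕ) :
    (esymm σ K d).IsHomogeneous d := by
  refine IsHomogeneous.sum _ _ _ fun t ht => ?_
  convert IsHomogeneous.prod t _ (fun _ => 1) fun i _ => isHomogeneous_X K i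
  simp [(Finset.mem_powersetCard.1 ht).2]

theorem esymm_sub_prod_mem_varIdeal {K σ : Type*} [Fintype σ] [DecidableEq σ] [Field K]
    (F : Finset σ) : esymm σ K Fᶜ.card - ∏ v ∈ Fᶜ, X v ∈ varIdeal K F := by
  rw [esymm, ← Finset.sum_erase_add (a := Fᶜ) _ _ (by simp), add_sub_cancel_right]
  refine Ideal.sum_mem _ fun t ht => ?_
  obtain ⟨hne, ht⟩ := Finset.mem_erase.1 ht
  have hsub : ¬ t ⊆ Fᶜ := fun h =>
    hne (Finset.eq_of_subset_of_card_le h (Finset.mem_powersetCard.1 ht).2.ge)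
  obtain ⟨v, hvt, hv⟩ := Finset.not_subset.1 hsub
  exact Ideal.mem_of_dvd _ (Finset.dvd_prod_of_mem _ hvt)
    (X_mem_varIdeal.2 (by simpa using hv))

/-- The list `e_1, …, e_d` of elementary symmetric polynomials. -/
noncomputable def esymmList (σ K : Type*) [Fintype σ] [Field K] (d : ℕ) :
    List (MvPolynomial σ K) :=
  (List.range d).map fun i => esymm σ K (i + 1)

theorem esymmList_succ (σ K : Type*) [Fintype σ] [Field K] (d : ℕ) :
    esymmList σ K (d + 1) = esymmList σ K d ++ [esymm σ K (d + 1)] := by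
  simp [esymmList, List.range_succ]

theorem exists_isHomogeneous_of_mem_esymmList {σ K : Type*} [Fintype σ] [Field K] {d : ℕ}
    {f : MvPolynomial σ K} (hf : f ∈ esymmList σ K d) : ∃ e, 0 < e ∧ f.IsHomogeneous e := by
  obtain ⟨i, _, rfl⟩ := List.mem_map.1 hf
  exact ⟨i + 1, i.succ_pos, esymm_isHomogeneous σ K (i + 1)⟩

theorem isWeaklyRegular_varIdeal_esymmList {K σ : Type*} [Fintype σ] [Field K] (F : Finset σ)
    (d : ℕ) (h : F.card + d ≤ Fintype.card σ) :
    IsWeaklyRegular (MvPolynomial σ K ⧸ varIdeal K F) (esymmList σ K d) := by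
  classical
  have key : ∀ (F : Finset σ) (d : ℕ), ∀ v ∉ F,
      IsWeaklyRegular (MvPolynomial σ K ⧸ varIdeal K (insert v F)) (esymmList σ K d) →
      IsWeaklyRegular (MvPolynomial σ K ⧸ varIdeal K F) (esymmList σ K d) ∧
        ∀ g, X v * g ∈ varIdeal K F ⊔ Ideal.ofList (esymmList σ K d) →
          g ∈ varIdeal K F ⊔ Ideal.ofList (esymmList σ K d) := by
    intro F d v hv hreg
    rw [← varIdeal_sup_span_X] at hreg
    exact isWeaklyRegular_of_isWeaklyRegular_sup (isHomogeneous_sqfreeIdeal _)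
      (isHomogeneous_X K v) one_pos (fun g hg => mem_varIdeal_of_X_mul_mem hv hg)
      (fun f hf => (exists_isHomogeneous_of_mem_esymmList hf).imp fun _ h => h.2) hreg
  induction d generalizing F with
  | zero => exact IsWeaklyRegular.nil _ _
  | succ d ih =>
    induction hr : Fintype.card σ - (F.card + (d + 1)) generalizing F with
    | zero =>
      have hcard : Fᶜ.card = d + 1 := by
        rw [Finset.card_compl]
        omega
      have hvar : ∀ v ∈ Fᶜ, IsWeaklyRegular
          (MvPolynomial σ K ⧸ varIdeal K (insert v F)) (esymmList σ K d) := fun v hv =>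
        ih _ (by rw [Finset.card_insert_of_notMem (by simpa using hv)]; omega)
      rw [esymmList_succ, isWeaklyRegular_quotient_concat_iff]
      refine ⟨ih F (by omega), fun g hg => ?_⟩
      refine mem_of_prod_mul_mem (x := X) (s := Fᶜ)
        (fun v hv => (key F d v (by simpa using hv) (hvar v hv)).2) ?_
      have := Ideal.mul_mem_right g _ (Ideal.mem_sup_left
        (T := Ideal.ofList (esymmList σ K d)) (esymm_sub_prod_mem_varIdeal (K := K) F))
      rw [hcard] at this
      convert Ideal.sub_mem _ hg this using 1
      ring
    | succ r ihr =>
      obtain ⟨v, hv⟩ : ∃ v, v ∉ F := by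
        by_contra! hall
        have := Finset.card_eq_iff_eq_univ F |>.2 (Finset.eq_univ_of_forall hall)
        omega
      refine (key F (d + 1) v hv (ihr _ ?_ ?_)).1 <;>
        rw [Finset.card_insert_of_notMem hv] <;> omega

theorem isPrime_varIdeal (K : Type*) [Field K] {σ : Type*} (F : Finset σ) :
    (varIdeal K F).IsPrime := by
  classical
  let φ : MvPolynomial σ K →ₐ[K] MvPolynomial σ K := aeval fun v => if v ∈ F then 0 else X v
  have hsub : ∀ p, p - φ p ∈ varIdeal K F := by
    intro p
    induction p using MvPolynomial.induction_on with
    | C a => simp [φ, algebraMap_eq]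
    | add p q hp hq =>
      rw [map_add, add_sub_add_comm]
      exact Ideal.add_mem _ hp hq
    | mul_X p v hp =>
      by_cases hv : v ∈ F
      · simpa [φ, hv] using Ideal.mul_mem_left _ p (X_mem_varIdeal.2 hv)
      · rw [map_mul, show φ (X v) = X v by simp [φ, hv], ← sub_mul]
        exact Ideal.mul_mem_right _ _ hp
  have hker : varIdeal K F = RingHom.ker φ := by
    refine le_antisymm (Ideal.span_le.2 ?_) fun p hp => ?_
    · rintro _ ⟨_, ⟨v, hv, rfl⟩, rfl⟩
      simpa [φ] using hv
    · simpa [RingHom.mem_ker.1 hp] using hsub p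
  rw [hker]
  exact RingHom.ker_isPrime φ

theorem card_le_height_varIdeal (K : Type*) [Field K] {σ : Type*} (F : Finset σ) :
    (F.card : ℕ∞) ≤ Order.height
      (⟨varIdeal K F, isPrime_varIdeal K F⟩ : PrimeSpectrum (MvPolynomial σ K)) := by
  classical
  induction F using Finset.induction_on with
  | empty => simp
  | insert v F hv ih =>
    rw [Finset.card_insert_of_notMem hv]
    push_cast
    refine (add_le_add_left ih 1).trans (Order.height_add_one_le ?_)
    refine lt_of_le_of_ne (fun p hp => ?_) fun h => hv ?_
    · change p ∈ varIdeal K (insert v F)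
      rw [← varIdeal_sup_span_X]
      exact Ideal.mem_sup_left hp
    · rw [← X_mem_varIdeal (K := K), show varIdeal K F = varIdeal K (insert v F) from
        congrArg PrimeSpectrum.asIdeal h]
      exact X_mem_varIdeal.2 (by simp)

theorem card_add_length_le {n : ℕ} {K : Type*} [Field K] {J : Ideal (MvPolynomial (Fin n) K)}
    (hJ : J.IsHomogeneous (homogeneousSubmodule (Fin n) K)) (F : Finset (Fin n))
    {w : MvPolynomial (Fin n) K} (hw : w ∉ J) (hFw : varIdeal K F ≤ J.colon {w})
    {fs : List (MvPolynomial (Fin n) K)}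
    (hhom : ∀ f ∈ fs, ∃ d, 0 < d ∧ f.IsHomogeneous d)
    (hfs : IsWeaklyRegular (MvPolynomial (Fin n) K ⧸ J) fs) :
    F.card + fs.length ≤ n := by
  let P : PrimeSpectrum (MvPolynomial (Fin n) K) := ⟨varIdeal K F, isPrime_varIdeal K F⟩
  have h1 := length_le_coheight hJ P hw
    (fun p hp => Submodule.mem_colon_singleton.1 (hFw hp)) hhom hfs
  have h2 : ((Order.height P + Order.coheight P : ℕ∞) : WithBot ℕ∞) ≤ n := by
    have hdim := MvPolynomial.ringKrullDim_of_isNoetherianRing (R := K) (ι := Fin n)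
    rw [ringKrullDim_eq_zero_of_field, zero_add, Nat.card_fin, ringKrullDim,
      Order.krullDim_eq_iSup_height_add_coheight_of_nonempty] at hdim
    rw [← hdim, WithBot.coe_le_coe]
    exact le_iSup (fun a => Order.height a + Order.coheight a) P
  have h3 := (add_le_add (card_le_height_varIdeal K F) h1).trans (WithBot.coe_le_coe.1 h2)
  exact_mod_cast h3

theorem one_mem_sqfreeIdeal {K : Type*} [Field K] {σ : Type*} {𝒜 : Set (Finset σ)} :
    (1 : MvPolynomial σ K) ∈ sqfreeIdeal K 𝒜 ↔ ∅ ∈ 𝒜 := by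
  simp [mem_sqfreeIdeal, ← Finset.eq_empty_iff_forall_notMem]

theorem isWeaklyRegular_quotient_top {R : Type*} [CommRing R] (fs : List R) :
    IsWeaklyRegular (R ⧸ (⊤ : Ideal R)) fs := by
  induction fs with
  | nil => exact IsWeaklyRegular.nil _ _
  | cons f fs ih =>
    rw [isWeaklyRegular_quotient_cons_iff, top_sup_eq]
    exact ⟨fun _ _ => trivial, ih⟩

/-- The ideal generated by the variables in `F` and the monomials on the windows
`[i, i + M - 1] ⊆ [1, N]` with `c < i`, with the positions in `G` removed; the position `l` stands
for the variable `X (y l)`. -/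
noncomputable def windowIdeal (K : Type*) [Field K] {σ : Type*} [DecidableEq σ] (y : ℕ → σ)
    (M N : ℕ) (F : Finset σ) (c : ℕ) (G : Finset ℕ) : Ideal (MvPolynomial σ K) :=
  sqfreeIdeal K ((fun v => {v}) '' (F : Set σ) ∪
    {A | ∃ i, c < i ∧ i + M ≤ N + 1 ∧ A = (Finset.Ico i (i + M) \ G).image y})

theorem windowIdeal_of_lt {K : Type*} [Field K] {σ : Type*} [DecidableEq σ] {y : ℕ → σ}
    {M N : ℕ} {F : Finset σ} {c : ℕ} {G : Finset ℕ} (h : N < c + M) :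
    windowIdeal K y M N F c G = varIdeal K F := by
  rw [windowIdeal, varIdeal]
  congr 1
  refine Set.union_eq_left.2 ?_
  rintro A ⟨i, hi, hi', -⟩
  omega

theorem windowIdeal_eq_top {K : Type*} [Field K] {σ : Type*} [DecidableEq σ] {y : ℕ → σ}
    {M N : ℕ} {F : Finset σ} {c : ℕ} {G : Finset ℕ} (h : c + M ≤ N)
    (hG : Finset.Ioc c (c + M) ⊆ G) : windowIdeal K y M N F c G = ⊤ := by
  rw [Ideal.eq_top_iff_one, windowIdeal, one_mem_sqfreeIdeal]
  refine Or.inr ⟨c + 1, by omega, by omega, ?_⟩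
  rw [eq_comm, Finset.image_eq_empty, Finset.sdiff_eq_empty_iff_subset]
  refine fun l hl => hG ?_
  simp only [Finset.mem_Ico, Finset.mem_Ioc] at hl ⊢
  omega

theorem windowIdeal_colon {K : Type*} [Field K] {σ : Type*} [DecidableEq σ] {y : ℕ → σ}
    {M N : ℕ} (hy : Set.InjOn y (Set.Icc 1 N)) {F : Finset σ} {c : ℕ} {G : Finset ℕ} {t : ℕ}
    (ht : 1 ≤ t) (htN : t ≤ N) (hF : y t ∉ F) :
    (windowIdeal K y M N F c G).colon {X (y t)} = windowIdeal K y M N F c (insert t G) := by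
  have h := colon_sqfreeIdeal (K := K) ((fun v => {v}) '' (F : Set σ) ∪
    {A | ∃ i, c < i ∧ i + M ≤ N + 1 ∧ A = (Finset.Ico i (i + M) \ G).image y}) {y t}
  rw [Finset.prod_singleton] at h
  rw [windowIdeal, windowIdeal, h, Set.image_union, Set.image_image]
  congr 2
  · refine Set.image_congr fun v hv => ?_
    rw [Finset.sdiff_singleton_eq_erase, Finset.erase_eq_of_notMem]
    rw [Finset.mem_singleton]
    rintro rfl
    exact hF hv
  · have hwin : ∀ i, c < i → i + M ≤ N + 1 → (Finset.Ico i (i + M) \ G).image y \ {y t} =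
        (Finset.Ico i (i + M) \ insert t G).image y := by
      intro i hi hi'
      ext v
      simp only [Finset.mem_sdiff, Finset.mem_image, Finset.mem_Ico, Finset.mem_singleton,
        Finset.mem_insert, not_or]
      constructor
      · rintro ⟨⟨l, hl, rfl⟩, hne⟩
        exact ⟨l, ⟨hl.1, fun h => hne (h ▸ rfl), hl.2⟩, rfl⟩
      · rintro ⟨l, hl, rfl⟩
        refine ⟨⟨l, ⟨hl.1, hl.2.2⟩, rfl⟩, fun h => hl.2.1 (hy ?_ ⟨ht, htN⟩ h)⟩
        exact ⟨by omega, by omega⟩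
    ext A
    constructor
    · rintro ⟨_, ⟨i, hi, hi', rfl⟩, rfl⟩
      exact ⟨i, hi, hi', hwin i hi hi'⟩
    · rintro ⟨i, hi, hi', rfl⟩
      exact ⟨_, ⟨i, hi, hi', rfl⟩, hwin i hi hi'⟩

theorem windowIdeal_sup_span_X {K : Type*} [Field K] {σ : Type*} [DecidableEq σ] {y : ℕ → σ}
    {M N : ℕ} {F : Finset σ} {c b t : ℕ} (hcb : c ≤ b) (hbt : b < t) (htM : t ≤ c + M) :
    windowIdeal K y M N F c (Finset.Ioc c b ∪ Finset.Ioc t (c + M)) ⊔ Ideal.span {X (y t)} =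
      windowIdeal K y M N (insert (y t) F) t (Finset.Ioc t (c + M)) := by
  have hwin : ∀ i, t < i → Finset.Ico i (i + M) \ (Finset.Ioc c b ∪ Finset.Ioc t (c + M)) =
      Finset.Ico i (i + M) \ Finset.Ioc t (c + M) := by
    intro i hi
    ext l
    simp only [Finset.mem_sdiff, Finset.mem_Ico, Finset.mem_union, Finset.mem_Ioc]
    omega
  rw [windowIdeal, sqfreeIdeal_union_singleton, windowIdeal]
  refine le_antisymm (sqfreeIdeal_le ?_) (sqfreeIdeal_le ?_)
  · rintro A ((⟨v, hv, rfl⟩ | ⟨i, hi, hi', rfl⟩) | rfl)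
    · exact ⟨_, Or.inl ⟨v, Finset.mem_insert_of_mem hv, rfl⟩, subset_rfl⟩
    · by_cases hit : t < i
      · exact ⟨_, Or.inr ⟨i, hit, hi', rfl⟩, by rw [hwin i hit]⟩
      · refine ⟨_, Or.inl ⟨y t, Finset.mem_insert_self _ _, rfl⟩, ?_⟩
        rw [Finset.singleton_subset_iff]
        refine Finset.mem_image_of_mem _ ?_
        simp only [Finset.mem_sdiff, Finset.mem_Ico, Finset.mem_union, Finset.mem_Ioc]
        omega
    · exact ⟨_, Or.inl ⟨y t, Finset.mem_insert_self _ _, rfl⟩, subset_rfl⟩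
  · rintro A (⟨v, hv, rfl⟩ | ⟨i, hi, hi', rfl⟩)
    · rcases Finset.mem_insert.1 hv with rfl | hv
      · exact ⟨_, Or.inr rfl, subset_rfl⟩
      · exact ⟨_, Or.inl (Or.inl ⟨v, hv, rfl⟩), subset_rfl⟩
    · exact ⟨_, Or.inl (Or.inr ⟨i, by omega, hi', rfl⟩), by rw [hwin i hi]⟩

theorem isWeaklyRegular_windowIdeal {K : Type*} [Field K] {σ : Type*} [DecidableEq σ] {y : ℕ → σ}
    {M N q B : ℕ} (hy : Set.InjOn y (Set.Icc 1 N)) (hN : N < q * (M + 1) + M)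
    {fs : List (MvPolynomial σ K)}
    (hfs : ∀ F : Finset σ, F.card ≤ B + 2 * q → IsWeaklyRegular (MvPolynomial σ K ⧸ varIdeal K F) fs)
    (F : Finset σ) (r j c b : ℕ) (hF : F.card ≤ B + r) (hr : r ≤ 2 * q) (hcb : c ≤ b)
    (hrj : (r = 2 * j ∧ j * (M + 1) ≤ c) ∨
      (r = 2 * j + 1 ∧ j * (M + 1) + 1 ≤ c ∧ j * (M + 1) + M ≤ b))
    (hyF : ∀ l, c < l → l ≤ N → y l ∉ F) :
    IsWeaklyRegular (MvPolynomial σ K ⧸ windowIdeal K y M N F c (Finset.Ioc c b)) fs := by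
  induction hd : N - c using Nat.strong_induction_on generalizing F r j c b with
  | _ d ih =>
  rcases lt_or_ge N (c + M) with hlt | hge
  · rw [windowIdeal_of_lt hlt]
    exact hfs F (by omega)
  rcases le_or_gt (c + M) b with hbM | hbM
  · rw [windowIdeal_eq_top hge (Finset.Ioc_subset_Ioc_right hbM)]
    exact isWeaklyRegular_quotient_top fs
  have hjq : j < q := by
    by_contra! hqj
    have := Nat.mul_le_mul_right (M + 1) hqj
    omega
  have inner : ∀ t, b ≤ t → t ≤ c + M → IsWeaklyRegular (MvPolynomial σ K ⧸
      windowIdeal K y M N F c (Finset.Ioc c b ∪ Finset.Ioc t (c + M))) fs := by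
    intro t hbt
    induction t, hbt using Nat.le_induction with
    | base =>
      intro hb
      rw [windowIdeal_eq_top hge (by rw [Finset.Ioc_union_Ioc_eq_Ioc hcb hb])]
      exact isWeaklyRegular_quotient_top fs
    | succ t hbt iht =>
      intro ht
      refine isWeaklyRegular_of_colon_of_sup (x := X (y (t + 1))) ?_ ?_
      · rw [windowIdeal_colon hy (by omega) (by omega) (hyF _ (by omega) (by omega))]
        have hset : insert (t + 1) (Finset.Ioc c b ∪ Finset.Ioc (t + 1) (c + M)) =
            Finset.Ioc c b ∪ Finset.Ioc t (c + M) := by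
          ext l
          simp only [Finset.mem_insert, Finset.mem_union, Finset.mem_Ioc]
          omega
        rw [hset]
        exact iht (by omega)
      · rw [windowIdeal_sup_span_X hcb (by omega) ht]
        have hstep : ((r + 1 = 2 * j + 1 ∧ j * (M + 1) + 1 ≤ t + 1 ∧ j * (M + 1) + M ≤ c + M)) ∨
            (r + 1 = 2 * (j + 1) ∧ (j + 1) * (M + 1) ≤ t + 1) := by
          rw [add_mul j 1]
          omega
        have hcard : (insert (y (t + 1)) F).card ≤ B + (r + 1) :=
          (Finset.card_insert_le _ _).trans (by omega)
        have hnotMem : ∀ l, t + 1 < l → l ≤ N → y l ∉ insert (y (t + 1)) F := by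
          intro l hl hlN
          rw [Finset.mem_insert, not_or]
          refine ⟨fun h => ?_, hyF l (by omega) hlN⟩
          have := hy ⟨by omega, hlN⟩ ⟨by omega, by omega⟩ h
          omega
        rcases hstep with h | h
        · exact ih (N - (t + 1)) (by omega) _ (r + 1) j _ _ hcard (by omega) ht (Or.inr h)
            hnotMem rfl
        · exact ih (N - (t + 1)) (by omega) _ (r + 1) (j + 1) _ _ hcard (by omega) ht (Or.inl h)
            hnotMem rfl
  have h := inner (c + M) hbM.le le_rfl
  rwa [Finset.Ioc_self, Finset.union_empty] at h

/-- The window of the `m` consecutive 1-indexed positions starting at `i`. -/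
def pathSet (n m i : ℕ) : Finset (Fin n) :=
  Finset.univ.filter fun j => i ≤ (j : ℕ) + 1 ∧ (j : ℕ) + 1 < i + m

theorem mem_pathSet {n m i : ℕ} {j : Fin n} :
    j ∈ pathSet n m i ↔ i ≤ (j : ℕ) + 1 ∧ (j : ℕ) + 1 < i + m := by
  simp [pathSet]

open Classical in
/-- The 1-indexed positions `m, 2m + 1, …, q(m + 1) - 1`. -/
noncomputable def cutSet (n m q : ℕ) : Finset (Fin n) :=
  Finset.univ.filter fun j => ∃ l ∈ Finset.Icc 1 q, (j : ℕ) + 2 = l * (m + 1)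

theorem mem_cutSet {n m q : ℕ} {j : Fin n} :
    j ∈ cutSet n m q ↔ ∃ l, (1 ≤ l ∧ l ≤ q) ∧ (j : ℕ) + 2 = l * (m + 1) := by
  simp [cutSet]

theorem pathIdeal_eq_sqfreeIdeal (K : Type) [Field K] (n m : ℕ) :
    pathIdeal K n m = sqfreeIdeal K (pathSet n m '' Set.Icc 1 (n - m + 1)) := by
  rw [pathIdeal, sqfreeIdeal, Set.image_image]
  congr 1
  ext p
  simp only [Set.mem_ofPred_eq, Set.mem_image, Set.mem_Icc, and_assoc, eq_comm (a := p)]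
  rfl

theorem xv_of_eq (K : Type) [Field K] {n t : ℕ} (v : Fin n) (h : (v : ℕ) + 1 = t) :
    xv K n t = X v := by
  have hv := v.isLt
  rw [xv, dif_pos (by omega)]
  congr 1
  ext
  simp only
  omega

theorem prod_xv_eq (K : Type) [Field K] {n m q : ℕ} (hm : 1 ≤ m) (hn : q * (m + 1) ≤ n + 1) :
    ∏ l ∈ Finset.Icc 1 q, xv K n (l * (m + 1) - 1) = ∏ j ∈ cutSet n m q, X j := by
  have hbd : ∀ l ∈ Finset.Icc 1 q, m + 1 ≤ l * (m + 1) ∧ l * (m + 1) ≤ n + 1 := by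
    intro l hl
    rw [Finset.mem_Icc] at hl
    have h1 := Nat.mul_le_mul_right (m + 1) hl.1
    have h2 := Nat.mul_le_mul_right (m + 1) hl.2
    omega
  refine Finset.prod_bij (fun l hl => ⟨l * (m + 1) - 2, by have := hbd l hl; omega⟩) ?_ ?_ ?_ ?_
  · intro l hl
    have := hbd l hl
    exact mem_cutSet.2 ⟨l, Finset.mem_Icc.1 hl, by simp only; omega⟩
  · intro l hl l' hl' h
    have h1 := hbd l hl
    have h2 := hbd l' hl'
    have h3 := Fin.mk.inj_iff.1 h
    exact Nat.eq_of_mul_eq_mul_right m.succ_pos (by omega : l * (m + 1) = l' * (m + 1))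
  · intro j hj
    obtain ⟨l, hl, h⟩ := mem_cutSet.1 hj
    refine ⟨l, Finset.mem_Icc.2 hl, ?_⟩
    ext
    simp only
    omega
  · intro l hl
    have := hbd l hl
    exact xv_of_eq K _ (by simp only; omega)

theorem colon_add_span_eq_sqfreeIdeal (K : Type) [Field K] {n m q : ℕ} (hm : 1 ≤ m)
    (hn : q * (m + 1) ≤ n + 1) (v : Fin n) (hv : (v : ℕ) + 2 = (q + 1) * (m + 1)) :
    (pathIdeal K n m).colon
        (Ideal.span {∏ l ∈ Finset.Icc 1 q, xv K n (l * (m + 1) - 1)}) +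
      Ideal.span {xv K n ((q + 1) * (m + 1) - 1)} =
    sqfreeIdeal K
      ((· \ cutSet n m q) '' (pathSet n m '' Set.Icc 1 (n - m + 1)) ∪ {{v}}) := by
  rw [Submodule.add_eq_sup, prod_xv_eq K hm hn, xv_of_eq K v (by omega), Ideal.colon_span,
    pathIdeal_eq_sqfreeIdeal, colon_sqfreeIdeal, sqfreeIdeal_union_singleton]

theorem sqfreeIdeal_pathSet_eq_windowIdeal (K : Type) [Field K] {n m q a : ℕ}
    (hn : n + 1 = (q + 1) * (m + 1) + a) (ha : a + 2 ≤ m) (v : Fin n)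
    (hv : (v : ℕ) + 2 = (q + 1) * (m + 1)) (y : ℕ → Fin n)
    (hy : ∀ l, 1 ≤ l → l ≤ q * m + (m - 2) → (y l : ℕ) + 1 = l + l / m) :
    sqfreeIdeal K ((· \ cutSet n m q) '' (pathSet n m '' Set.Icc 1 (n - m + 1)) ∪ {{v}}) =
      windowIdeal K y (m - 1) (q * m + (m - 2)) {v} 0 ∅ := by
  have hexp : ∀ x, (x + 1) * (m + 1) = x * (m + 1) + m + 1 := fun x => by ring
  have hexp' : ∀ x, x * (m + 1) = x * m + x := fun x => by ring
  have hexp'' : ∀ x, (x + 1) * m = x * m + m := fun x => by ring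
  have hq := hexp q
  refine le_antisymm (sqfreeIdeal_le ?_) (sqfreeIdeal_le ?_)
  · rintro A (⟨_, ⟨i, ⟨hi1, hin⟩, rfl⟩, rfl⟩ | rfl)
    · by_cases hvi : v ∈ pathSet n m i
      · refine ⟨{v}, Or.inl ⟨v, by simp, rfl⟩, ?_⟩
        rw [Finset.singleton_subset_iff, Finset.mem_sdiff]
        refine ⟨hvi, fun h => ?_⟩
        obtain ⟨l, hl, h⟩ := mem_cutSet.1 h
        have := Nat.mul_le_mul_right (m + 1) hl.2
        omega
      · rw [mem_pathSet] at hvi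
        obtain ⟨Q, r, hr, rfl⟩ : ∃ Q r, r ≤ m ∧ i = Q * (m + 1) + r :=
          ⟨i / (m + 1), i % (m + 1), Nat.le_of_lt_succ (Nat.mod_lt _ m.succ_pos),
            by rw [mul_comm, Nat.div_add_mod]⟩
        have hQq : Q ≤ q := by
          by_contra! h
          have := Nat.mul_le_mul_right (m + 1) (Nat.succ_le_of_lt h)
          rw [Nat.succ_eq_add_one] at this
          omega
        have hbd : Q * m + r ≤ q * m := by
          rcases hQq.lt_or_eq with h | rfl
          · have := Nat.mul_le_mul_right m (Nat.succ_le_of_lt h)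
            rw [Nat.succ_eq_add_one, hexp''] at this
            omega
          · omega
        have hpos : 0 < Q * m + r := by
          rcases Nat.eq_zero_or_pos Q with rfl | h
          · omega
          · have := Nat.mul_pos h (by omega : 0 < m)
            omega
        refine ⟨_, Or.inr ⟨Q * m + r, hpos, by omega, rfl⟩, ?_⟩
        rw [Finset.sdiff_empty]
        intro j hj
        obtain ⟨l, hl, rfl⟩ := Finset.mem_image.1 hj
        rw [Finset.mem_Ico] at hl
        have hyl := hy l (by omega) (by omega)
        have hQm := hexp' Q
        have hl1 : Q ≤ l / m := (Nat.le_div_iff_mul_le (by omega)).2 (by omega)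
        have hl2 : l / m < Q + 2 := (Nat.div_lt_iff_lt_mul (by omega)).2 (by
          rw [hexp'', hexp'']; omega)
        have hl3 : l / m = Q + 1 ∨ l / m = Q := by omega
        rw [Finset.mem_sdiff, mem_pathSet, mem_cutSet]
        refine ⟨by omega, ?_⟩
        rintro ⟨D, -, hD⟩
        have hdm := Nat.div_add_mod l m
        have hmod := Nat.mod_lt l (by omega : 0 < m)
        have h1 : l + l / m + 1 = (m + 1) * (l / m) + (l % m + 1) := by
          rw [add_mul, one_mul]
          omega
        have h2 : (l + l / m + 1) % (m + 1) = l % m + 1 := by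
          rw [h1, Nat.mul_add_mod, Nat.mod_eq_of_lt (by omega)]
        rw [show l + l / m + 1 = D * (m + 1) by omega, Nat.mul_mod_left] at h2
        omega
    · exact ⟨{v}, Or.inl ⟨v, by simp, rfl⟩, subset_rfl⟩
  · rintro A (⟨w, hw, rfl⟩ | ⟨i, hi, hin, rfl⟩)
    · rw [Finset.coe_singleton, Set.mem_singleton_iff] at hw
      exact ⟨_, Or.inr rfl, by rw [hw]⟩
    · obtain ⟨Q, r, hr, rfl⟩ : ∃ Q r, r < m ∧ i = Q * m + r + 1 :=
        ⟨(i - 1) / m, (i - 1) % m, Nat.mod_lt _ (by omega),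
          by rw [mul_comm, Nat.div_add_mod]; omega⟩
      have hQq : Q < q := by
        by_contra! h
        have := Nat.mul_le_mul_right m h
        omega
      have hQq' := Nat.mul_le_mul_right (m + 1) (Nat.succ_le_of_lt hQq)
      have hQ1 := hexp Q
      have hQm := hexp' Q
      rw [Nat.succ_eq_add_one] at hQq'
      refine ⟨_, Or.inl ⟨_, ⟨Q * (m + 1) + r + 1, ⟨by omega, by omega⟩, rfl⟩, rfl⟩, ?_⟩
      intro j hj
      rw [Finset.mem_sdiff, mem_pathSet] at hj
      obtain ⟨hj, hjc⟩ := hj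
      obtain ⟨D, R, hR, hjD⟩ : ∃ D R, R < m + 1 ∧ (j : ℕ) + 1 = D * (m + 1) + R :=
        ⟨_, _, Nat.mod_lt _ m.succ_pos, (by rw [mul_comm, Nat.div_add_mod])⟩
      have hD1 : Q ≤ D := by
        by_contra! h
        have := Nat.mul_le_mul_right (m + 1) (Nat.succ_le_of_lt h)
        rw [Nat.succ_eq_add_one, hexp] at this
        omega
      have hD2 : D ≤ Q + 1 := by
        by_contra! h
        have := Nat.mul_le_mul_right (m + 1) (Nat.succ_le_of_lt h)
        rw [Nat.succ_eq_add_one, hexp] at this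
        omega
      have hRm : R ≠ m := by
        rintro rfl
        refine hjc (mem_cutSet.2 ⟨D + 1, ⟨by omega, ?_⟩, by rw [hexp]; omega⟩)
        rcases (by omega : D = Q ∨ D = Q + 1) with rfl | rfl <;> omega
      have hl : Q * m + r + 1 ≤ D * m + R ∧ D * m + R < Q * m + r + 1 + (m - 1) := by
        have h1 := hexp'' Q
        rcases (by omega : D = Q ∨ D = Q + 1) with rfl | rfl <;> omega
      refine Finset.mem_image.2 ⟨D * m + R, ?_, ?_⟩
      · rw [Finset.sdiff_empty, Finset.mem_Ico]
        exact hl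
      · have hyl := hy (D * m + R) (by omega) (by omega)
        have hdiv : (D * m + R) / m = D := by
          rw [mul_comm, Nat.mul_add_div (by omega), Nat.div_eq_of_lt (by omega), add_zero]
        have := hexp' D
        rw [hdiv] at hyl
        ext
        omega

theorem exists_card_le_varIdeal_le_colon (K : Type) [Field K] {n m q : ℕ} (hm : 3 ≤ m)
    (hn : (q + 1) * (m + 1) ≤ n + 1) (hn' : n < (q + 1) * (m + 1) + m - 1) (v : Fin n)
    (hv : (v : ℕ) + 2 = (q + 1) * (m + 1)) {J : Ideal (MvPolynomial (Fin n) K)}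
    (hJ : J = sqfreeIdeal K
      ((· \ cutSet n m q) '' (pathSet n m '' Set.Icc 1 (n - m + 1)) ∪ {{v}})) :
    ∃ (F : Finset (Fin n)) (w : MvPolynomial (Fin n) K), 2 * q + 1 ≤ F.card ∧ w ∉ J ∧
      varIdeal K F ≤ J.colon {w} := by
  classical
  have hexp : ∀ x, (x + 1) * (m + 1) = x * (m + 1) + m + 1 := fun x => by ring
  have hlt : ∀ {x z}, x < z → x * (m + 1) + m + 1 ≤ z * (m + 1) := fun {x z} h => by
    rw [← hexp]
    exact Nat.mul_le_mul_right _ h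
  have hq := hexp q
  have hcut : ∀ j : Fin n, j ∈ cutSet n m q → ∃ l, l ≤ q ∧ (j : ℕ) + 2 = l * (m + 1) := by
    intro j hj
    obtain ⟨l, hl, h⟩ := mem_cutSet.1 hj
    exact ⟨l, hl.2, h⟩
  let F : Finset (Fin n) := Finset.univ.filter fun j => j = v ∨
    ∃ l, (1 ≤ l ∧ l ≤ q) ∧ ((j : ℕ) + 3 = l * (m + 1) ∨ (j : ℕ) + 1 = l * (m + 1))
  have hF : ∀ j, j ∈ F ↔ j = v ∨
      ∃ l, (1 ≤ l ∧ l ≤ q) ∧ ((j : ℕ) + 3 = l * (m + 1) ∨ (j : ℕ) + 1 = l * (m + 1)) :=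
    fun j => by simp [F]
  have hFcut : ∀ j ∈ F, j ∉ cutSet n m q := by
    intro j hj hjc
    obtain ⟨l', hl', h'⟩ := hcut j hjc
    rcases (hF j).1 hj with rfl | ⟨l, -, h⟩
    · have := hlt (Nat.lt_succ_of_le hl')
      rw [Nat.succ_eq_add_one] at this
      omega
    · rcases lt_trichotomy l l' with h1 | rfl | h1
      · have := hlt h1
        omega
      · omega
      · have := hlt h1
        omega
  refine ⟨F, ∏ j ∈ Fᶜ, X j, ?_, ?_, ?_⟩
  · let g : ℕ → ℕ := fun t => (t / 2 + 1) * (m + 1) - 3 + 2 * (t % 2)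
    have hg : ∀ t, (t / 2 + 1) * (m + 1) ≥ m + 1 := fun t => by
      have := Nat.mul_le_mul_right (m + 1) (Nat.le_add_left 1 (t / 2))
      omega
    have hginj : ∀ t t', t < t' → g t < g t' := by
      intro t t' h
      have h1 := hg t
      have h2 := hg t'
      simp only [g]
      rcases (by omega : t / 2 < t' / 2 ∨ t / 2 = t' / 2) with h3 | h3
      · have := hlt (by omega : t / 2 + 1 < t' / 2 + 1)
        omega
      · rw [h3]
        omega
    have hgq : ∀ t ∈ Finset.range (2 * q), g t + 2 < (q + 1) * (m + 1) := by
      intro t ht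
      have h1 := hg t
      rw [Finset.mem_range] at ht
      have := hlt (by omega : t / 2 + 1 < q + 1)
      simp only [g]
      omega
    have hnotMem : (v : ℕ) ∉ (Finset.range (2 * q)).image g := by
      intro h
      obtain ⟨t, ht, h⟩ := Finset.mem_image.1 h
      have := hgq t ht
      omega
    have hcard : (insert (v : ℕ) ((Finset.range (2 * q)).image g)).card = 2 * q + 1 := by
      rw [Finset.card_insert_of_notMem hnotMem,
        Finset.card_image_of_injective _ (StrictMono.injective fun t t' => hginj t t'),
        Finset.card_range]
    rw [← hcard]
    refine (Finset.card_le_card ?_).trans (Finset.card_image_le (f := Fin.val))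
    intro x hx
    rcases Finset.mem_insert.1 hx with rfl | hx
    · exact Finset.mem_image_of_mem _ ((hF v).2 (Or.inl rfl))
    · obtain ⟨t, ht, rfl⟩ := Finset.mem_image.1 hx
      have h1 := hgq t ht
      have h2 := hg t
      rw [Finset.mem_range] at ht
      refine Finset.mem_image.2 ⟨⟨g t, by omega⟩, (hF _).2 (Or.inr ⟨t / 2 + 1, by omega, ?_⟩), rfl⟩
      simp only [g]
      omega
  · intro hw
    have h1 : (1 : MvPolynomial (Fin n) K) ∈ J.colon {∏ j ∈ Fᶜ, X j} := by
      rwa [Submodule.mem_colon_singleton, one_smul]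
    rw [hJ, colon_sqfreeIdeal, one_mem_sqfreeIdeal] at h1
    obtain ⟨A, hA, hAF⟩ := h1
    rw [Finset.sdiff_eq_empty_iff_subset] at hAF
    suffices ∃ j ∈ F, j ∈ A by
      obtain ⟨j, hjF, hjA⟩ := this
      exact Finset.mem_compl.1 (hAF hjA) hjF
    rcases hA with ⟨_, ⟨i, ⟨hi1, hin⟩, rfl⟩, rfl⟩ | rfl
    · suffices ∃ j ∈ F, j ∈ pathSet n m i by
        obtain ⟨j, hjF, hjA⟩ := this
        exact ⟨j, hjF, Finset.mem_sdiff.2 ⟨hjA, hFcut j hjF⟩⟩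
      by_cases hvi : v ∈ pathSet n m i
      · exact ⟨v, (hF v).2 (Or.inl rfl), hvi⟩
      rw [mem_pathSet] at hvi
      obtain ⟨Q, r, hr, rfl⟩ : ∃ Q r, r ≤ m ∧ i = Q * (m + 1) + r :=
        ⟨i / (m + 1), i % (m + 1), Nat.le_of_lt_succ (Nat.mod_lt _ m.succ_pos),
          by rw [mul_comm, Nat.div_add_mod]⟩
      have hQq : Q ≤ q := by
        by_contra! h
        have := hlt h
        omega
      have hQ := hexp Q
      rcases hQq.lt_or_eq with h | rfl
      · have hlt' := hlt h
        rcases hr.lt_or_eq with hr | rfl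
        · exact ⟨⟨(Q + 1) * (m + 1) - 3, by omega⟩,
            (hF _).2 (Or.inr ⟨Q + 1, by omega, by simp only; omega⟩),
            mem_pathSet.2 (by simp only; omega)⟩
        · exact ⟨⟨(Q + 1) * (r + 1) - 1, by omega⟩,
            (hF _).2 (Or.inr ⟨Q + 1, by omega, by simp only; omega⟩),
            mem_pathSet.2 (by simp only; omega)⟩
      · have hQ0 : 1 ≤ Q := by
          rw [Nat.one_le_iff_ne_zero]
          rintro rfl
          omega
        exact ⟨⟨Q * (m + 1) - 1, by omega⟩,
          (hF _).2 (Or.inr ⟨Q, by omega, by simp only; omega⟩),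
          mem_pathSet.2 (by simp only; omega)⟩
    · exact ⟨v, (hF v).2 (Or.inl rfl), Finset.mem_singleton_self v⟩
  · rw [hJ, colon_sqfreeIdeal, varIdeal]
    refine sqfreeIdeal_le ?_
    rintro _ ⟨u, hu, rfl⟩
    suffices ∃ A ∈ (· \ cutSet n m q) '' (pathSet n m '' Set.Icc 1 (n - m + 1)) ∪ {{v}},
        ∀ j ∈ A, j ∈ F → j = u by
      obtain ⟨A, hA, h⟩ := this
      refine ⟨_, ⟨A, hA, rfl⟩, fun j hj => ?_⟩
      rw [Finset.mem_sdiff, Finset.mem_compl, not_not] at hj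
      exact Finset.mem_singleton.2 (h j hj.1 hj.2)
    rcases (hF u).1 hu with rfl | ⟨l, hl, h⟩
    · exact ⟨_, Or.inr rfl, fun j hj _ => Finset.mem_singleton.1 hj⟩
    have hlq := hlt (Nat.lt_succ_of_le hl.2)
    rw [Nat.succ_eq_add_one] at hlq
    have hl1 := Nat.mul_le_mul_right (m + 1) hl.1
    obtain ⟨i, hi⟩ : ∃ i, i + m = (u : ℕ) + 3 ∧ (u : ℕ) + 3 = l * (m + 1) ∨
        i = (u : ℕ) ∧ (u : ℕ) + 1 = l * (m + 1) := by
      rcases h with h | h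
      · exact ⟨u + 3 - m, by omega⟩
      · exact ⟨u, by omega⟩
    refine ⟨_, Or.inl ⟨_, ⟨i, ⟨by omega, by omega⟩, rfl⟩, rfl⟩, fun j hj hjF => ?_⟩
    obtain ⟨hji, hjc⟩ := Finset.mem_sdiff.1 hj
    rw [mem_pathSet] at hji
    rcases (hF j).1 hjF with rfl | ⟨l', -, h'⟩
    · omega
    rcases lt_trichotomy l l' with h1 | rfl | h1
    · have := hlt h1
      omega
    · omega
    · have := hlt h1
      omega

theorem mem_span_range_X_iff {K : Type*} [Field K] {σ : Type*} {f : MvPolynomial σ K} :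
    f ∈ Ideal.span (Set.range (X : σ → MvPolynomial σ K)) ↔ ∀ s ∈ f.support, s ≠ 0 := by
  rw [← Set.image_univ, mem_ideal_span_X_image]
  simp [Finsupp.ext_iff]

theorem mem_span_range_X_of_isHomogeneous {K : Type*} [Field K] {σ : Type*}
    {f : MvPolynomial σ K} {e : ℕ} (he : 0 < e) (hf : f.IsHomogeneous e) :
    f ∈ Ideal.span (Set.range (X : σ → MvPolynomial σ K)) := by
  rw [mem_span_range_X_iff]
  rintro s hs rfl
  rw [mem_support_iff] at hs
  refine hs (hf.coeff_eq_zero ?_)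
  rw [map_zero]
  exact he.ne

theorem exists_pos_isHomogeneous_of_mem_span_range_X {K : Type*} [Field K] {σ : Type*}
    {f : MvPolynomial σ K} {e : ℕ} (hf : f.IsHomogeneous e)
    (hfX : f ∈ Ideal.span (Set.range (X : σ → MvPolynomial σ K))) :
    ∃ d, 0 < d ∧ f.IsHomogeneous d := by
  rcases Nat.eq_zero_or_pos e with rfl | he
  · suffices f = 0 by
      rw [this]
      exact ⟨1, one_pos, isHomogeneous_zero σ K 1⟩
    rw [mem_span_range_X_iff] at hfX
    rw [← support_eq_empty, Finset.eq_empty_iff_forall_notMem]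
    refine fun s hs => hfX s hs ?_
    by_contra hs0
    refine mem_support_iff.1 hs (hf.coeff_eq_zero ?_)
    rwa [Ne, Finsupp.degree_eq_zero_iff]
  · exact ⟨e, he, hf⟩

theorem sqfreeIdeal_le_span_range_X {K : Type*} [Field K] {σ : Type*} {𝒜 : Set (Finset σ)}
    (h : ∅ ∉ 𝒜) : sqfreeIdeal K 𝒜 ≤ Ideal.span (Set.range (X : σ → MvPolynomial σ K)) := by
  intro p hp
  rw [mem_sqfreeIdeal] at hp
  rw [mem_span_range_X_iff]
  rintro s hs rfl
  obtain ⟨A, hA, hA0⟩ := hp 0 hs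
  have : A = ∅ := Finset.eq_empty_iff_forall_notMem.2 fun i hi => hA0 i hi rfl
  exact h (this ▸ hA)

theorem isRegular_quotient_of_le {R : Type*} [CommRing R] {I P : Ideal R} (hP : P ≠ ⊤)
    (hIP : I ≤ P) {fs : List R} (hfP : ∀ f ∈ fs, f ∈ P) (hfs : IsWeaklyRegular (R ⧸ I) fs) :
    IsRegular (R ⧸ I) fs := by
  refine ⟨hfs, fun h => hP ?_⟩
  have hle : Ideal.ofList fs ≤ P := Ideal.span_le.2 hfP
  have h1 : (1 : R ⧸ I) ∈ (Ideal.ofList fs • ⊤ : Submodule R (R ⧸ I)) := h ▸ Submodule.mem_top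
  rw [Ideal.smul_top_eq_map, Submodule.restrictScalars_mem] at h1
  have h2 := Ideal.map_mono (f := algebraMap R (R ⧸ I)) hle h1
  rw [Ideal.Quotient.algebraMap_eq, ← map_one (Ideal.Quotient.mk I),
    Ideal.mem_quotient_iff_mem hIP] at h2
  exact (Ideal.eq_top_iff_one P).2 h2

theorem isWeaklyRegular_sqfreeIdeal_pathSet (K : Type) [Field K] {n m q a : ℕ}
    (hn : n + 1 = (q + 1) * (m + 1) + a) (ha : a + 2 ≤ m) (v : Fin n)
    (hv : (v : ℕ) + 2 = (q + 1) * (m + 1)) {fs : List (MvPolynomial (Fin n) K)}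
    (hfs : ∀ F : Finset (Fin n), F.card ≤ 1 + 2 * q →
      IsWeaklyRegular (MvPolynomial (Fin n) K ⧸ varIdeal K F) fs) :
    IsWeaklyRegular (MvPolynomial (Fin n) K ⧸ sqfreeIdeal K
      ((· \ cutSet n m q) '' (pathSet n m '' Set.Icc 1 (n - m + 1)) ∪ {{v}})) fs := by
  have hvn := v.isLt
  have hexp : (q + 1) * (m + 1) = q * m + q + m + 1 := by ring
  have hdiv : ∀ l, l ≤ q * m + (m - 2) → l / m ≤ q := by
    intro l hl
    refine Nat.le_of_lt_succ ((Nat.div_lt_iff_lt_mul (by omega)).2 ?_)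
    rw [Nat.succ_mul]
    omega
  let y : ℕ → Fin n := fun l => ⟨(l + l / m - 1) % n, Nat.mod_lt _ (by omega)⟩
  have hy : ∀ l, 1 ≤ l → l ≤ q * m + (m - 2) → (y l : ℕ) + 1 = l + l / m := by
    intro l hl hl'
    have := hdiv l hl'
    simp only [y]
    generalize l / m = z at *
    rw [Nat.mod_eq_of_lt (by omega)]
    omega
  have hyv : ∀ l, 1 ≤ l → l ≤ q * m + (m - 2) → y l ≠ v := by
    intro l hl hl' h
    have h1 := hdiv l hl'
    have h2 := hy l hl hl'
    rw [h] at h2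
    omega
  have hinj : Set.InjOn y (Set.Icc 1 (q * m + (m - 2))) := by
    intro l hl l' hl' h
    have h1 := hy l hl.1 hl.2
    have h2 := hy l' hl'.1 hl'.2
    rw [h] at h1
    rcases lt_trichotomy l l' with h3 | h3 | h3
    · have := Nat.div_le_div_right (c := m) h3.le
      omega
    · exact h3
    · have := Nat.div_le_div_right (c := m) h3.le
      omega
  rw [sqfreeIdeal_pathSet_eq_windowIdeal K hn ha v hv y hy]
  have h := isWeaklyRegular_windowIdeal (B := 1) (q := q) (M := m - 1) hinj
    (by rw [Nat.sub_add_cancel (by omega)]; omega) hfs {v} 0 0 0 0 (by simp) (by omega) le_rfl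
    (Or.inl (by simp)) fun l hl hl' => by
      rw [Finset.mem_singleton]
      exact hyv l hl hl'
  rwa [Finset.Ioc_self] at h

/-- For `m ≥ 3`, `n ≥ 2m`, `k = ⌊(n+1)/(m+1)⌋`, `a = n+1-k(m+1)` with `1 < a < m-1`:
with `L_{k-1} = (I_{n,m} : x_m x_{2m+1} ⋯ x_{(k-1)(m+1)-1})` and
`U_k = L_{k-1} + (x_{k(m+1)-1})`, one has
`depth(S/U_k) = n − 2k + 1 = (n + 1 − ⌊(n+1)/(m+1)⌋ − ⌈(n+1)/(m+1)⌉) + 1`. -/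
theorem stmt_14 (K : Type) [Field K] (n m : ℕ) (hm : 3 ≤ m) (hn : 2 * m ≤ n)
    (k : ℕ) (hk : k = (n + 1) / (m + 1)) (a : ℕ) (ha : a = n + 1 - k * (m + 1))
    (ha1 : 1 < a) (ha2 : a < m - 1)
    (U : Ideal (MvPolynomial (Fin n) K))
    (hU : U = (pathIdeal K n m).colon
        (Ideal.span {∏ l ∈ Finset.Icc 1 (k - 1), xv K n (l * (m + 1) - 1)}) +
      Ideal.span {xv K n (k * (m + 1) - 1)}) :
    IsGreatest (homogRegSeqLengths K n U) (n - 2 * k + 1) ∧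
    n - 2 * k + 1 = (n + 1 - (n + 1) / (m + 1) - (n + m + 1) / (m + 1)) + 1 := by
  have hkm : k * (m + 1) ≤ n + 1 := hk ▸ Nat.div_mul_le_self _ _
  have hk2 : 2 ≤ k := by
    rw [hk, Nat.le_div_iff_mul_le m.succ_pos]
    by_contra! h
    have : (n + 1) / (m + 1) < 2 := (Nat.div_lt_iff_lt_mul m.succ_pos).2 h
    have h1 : k = 1 ∨ k = 0 := by omega
    rcases h1 with rfl | rfl <;> omega
  obtain ⟨q, rfl⟩ : ∃ q, k = q + 1 := ⟨k - 1, by omega⟩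
  have hexp : (q + 1) * (m + 1) = q * (m + 1) + m + 1 := by ring
  have hq4 : q * 4 ≤ q * (m + 1) := Nat.mul_le_mul_left q (by omega)
  have hceil : (n + m + 1) / (m + 1) = q + 2 := by
    rw [show n + m + 1 = (a - 1) + (m + 1) * (q + 2) by rw [mul_comm (m + 1), add_mul]; omega,
      Nat.add_mul_div_left _ _ m.succ_pos, Nat.div_eq_of_lt (by omega), zero_add]
  refine ⟨?_, by rw [← hk, hceil]; omega⟩
  let v : Fin n := ⟨(q + 1) * (m + 1) - 2, by omega⟩
  have hv : (v : ℕ) + 2 = (q + 1) * (m + 1) := by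
    simp only [v]
    omega
  rw [Nat.add_sub_cancel, colon_add_span_eq_sqfreeIdeal K (by omega) (by omega) v hv] at hU
  obtain ⟨F, w, hF, hw, hFw⟩ := exists_card_le_varIdeal_le_colon K hm hkm (by omega) v hv hU
  constructor
  · have hP : Ideal.span (Set.range (X : Fin n → MvPolynomial (Fin n) K)) ≠ ⊤ := by
      rw [Ideal.ne_top_iff_one, mem_span_range_X_iff]
      simp
    have hUP : U ≤ Ideal.span (Set.range (X : Fin n → MvPolynomial (Fin n) K)) := by
      rw [hU]
      refine sqfreeIdeal_le_span_range_X fun h => hw ?_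
      rw [hU, (Ideal.eq_top_iff_one _).2 (one_mem_sqfreeIdeal.2 h)]
      exact Submodule.mem_top
    have hmem : ∀ f ∈ esymmList (Fin n) K (n - 2 * (q + 1) + 1),
        f ∈ Ideal.span (Set.range (X : Fin n → MvPolynomial (Fin n) K)) := by
      intro f hf
      obtain ⟨e, he, hfe⟩ := exists_isHomogeneous_of_mem_esymmList hf
      exact mem_span_range_X_of_isHomogeneous he hfe
    refine ⟨esymmList (Fin n) K (n - 2 * (q + 1) + 1), by simp [esymmList],
      fun f hf => ⟨?_, hmem f hf⟩, isRegular_quotient_of_le hP hUP hmem ?_⟩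
    · obtain ⟨e, -, hfe⟩ := exists_isHomogeneous_of_mem_esymmList hf
      exact ⟨e, hfe⟩
    · rw [hU]
      refine isWeaklyRegular_sqfreeIdeal_pathSet K (a := a) (by omega) (by omega) v hv
        fun F' hF' => isWeaklyRegular_varIdeal_esymmList F' _ ?_
      rw [Fintype.card_fin]
      omega
  · rintro d ⟨rs, rfl, hrs, hreg⟩
    have := card_add_length_le (hU ▸ isHomogeneous_sqfreeIdeal _) F hw hFw
      (fun f hf => exists_pos_isHomogeneous_of_mem_span_range_X (hrs f hf).1.choose_spec
        (hrs f hf).2) hreg.toIsWeaklyRegular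
    omega
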